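/- arXiv:2306.09571 — 2 statements merged into one kernel-verified Lean document; each statement's English description precedes it below -/
import Mathlib

section
/- Let d ≥ 1, p ≥ 1, let Ω ⊆ ℝ^d × ℝ be open, (z, s) ∈ Ω, and let ψ : ℝ^d × ℝ → ℂ be infinitely differentiable on Ω with i ∂_t ψ + (1/2) Δ_x ψ = 0 on Ω. Let T^{p+1}(x, t) := Σ_{|j_x| + j_t ≤ p} (1/(j_x! j_t!)) D^{(j_x, j_t)} ψ(z, s) (x − z)^{j_x} (t − s)^{j_t} be the Taylor polynomial of order p + 1 of ψ centered at (z, s). Then for all (x, t) ∈ ℝ^d × ℝ: −2i ∂_t T^{p+1}(x, t) = Δ_x T^{p+1}(x, t) + Σ_{|j_x| + j_t = p − 1} Σ_{ℓ=1}^d (1/(j_x! j_t!)) D^{(j_x + 2e_ℓ, j_t)} ψ(z, s) (x − z)^{j_x} (t − s)^{j_t}. -/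
noncomputable section

/-- Spatial partial derivative `∂/∂x_ℓ` of a function on `ℝ^d × ℝ`. -/
def pS (d : ℕ) (ℓ : Fin d) (f : (Fin d → ℝ) × ℝ → ℂ) : (Fin d → ℝ) × ℝ → ℂ :=
  fun y => fderiv ℝ f y (Pi.single ℓ 1, 0)

/-- Time partial derivative `∂/∂t` of a function on `ℝ^d × ℝ`. -/
def pT (d : ℕ) (f : (Fin d → ℝ) × ℝ → ℂ) : (Fin d → ℝ) × ℝ → ℂ :=
  fun y => fderiv ℝ f y (0, 1)

/-- Multi-index partial derivative `D^{(j_x, j_t)}`. -/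
def Dm (d : ℕ) (jx : Fin d → ℕ) (jt : ℕ) (f : (Fin d → ℝ) × ℝ → ℂ) : (Fin d → ℝ) × ℝ → ℂ :=
  (pT d)^[jt] ((List.finRange d).foldr (fun ℓ g => (pS d ℓ)^[jx ℓ] ∘ g) id f)

/-- The Taylor polynomial of order `p + 1` (degree `p`) of `ψ` centered at `(z, s)`:
`T^{p+1}(x,t) = Σ_{|j_x| + j_t ≤ p} (1/(j_x! j_t!)) D^{(j_x,j_t)} ψ(z,s) (x−z)^{j_x} (t−s)^{j_t}`. -/
def taylorPoly (d p : ℕ) (ψ : (Fin d → ℝ) × ℝ → ℂ) (z : Fin d → ℝ) (s : ℝ) :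
    (Fin d → ℝ) × ℝ → ℂ := fun y =>
  ∑ jt ∈ Finset.range (p + 1),
    ∑ jx ∈ Fintype.piFinset (fun _ : Fin d => Finset.range (p + 1)),
      if (∑ ℓ, jx ℓ) + jt ≤ p then
        (((∏ ℓ, (jx ℓ).factorial) * jt.factorial : ℕ) : ℂ)⁻¹ * Dm d jx jt ψ (z, s) *
          (∏ ℓ, ((y.1 ℓ - z ℓ : ℝ) : ℂ) ^ jx ℓ) * ((y.2 - s : ℝ) : ℂ) ^ jt
      else 0

section IteratedDirectionalDerivative

variable {E : Type*} [NormedAddCommGroup E] [NormedSpace ℝ E]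

/-- Derivative of `f` in the direction `v`. -/
def dirDeriv (v : E) (f : E → ℂ) : E → ℂ := fun y => fderiv ℝ f y v

/-- Iterated derivative of `f` along the directions in a list, the head being applied last. -/
def iterDirDeriv (L : List E) (f : E → ℂ) : E → ℂ := L.foldr dirDeriv f

variable {Ω : Set E} {f g : E → ℂ}

theorem iterDirDeriv_append (L L' : List E) (f : E → ℂ) :
    iterDirDeriv (L ++ L') f = iterDirDeriv L (iterDirDeriv L' f) :=
  List.foldr_append

theorem iterDirDeriv_replicate (v : E) (n : ℕ) (f : E → ℂ) :
    iterDirDeriv (List.replicate n v) f = (dirDeriv v)^[n] f := by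
  induction n with
  | zero => rfl
  | succ n ih =>
    rw [Function.iterate_succ_apply', ← ih]
    rfl

theorem ContDiffOn.dirDeriv (hΩ : IsOpen Ω) (hf : ContDiffOn ℝ (⊤ : ℕ∞) f Ω) (v : E) :
    ContDiffOn ℝ (⊤ : ℕ∞) (dirDeriv v f) Ω :=
  (hf.fderiv_of_isOpen hΩ (by simp)).clm_apply contDiffOn_const

theorem ContDiffOn.iterDirDeriv (hΩ : IsOpen Ω) (hf : ContDiffOn ℝ (⊤ : ℕ∞) f Ω) (L : List E) :
    ContDiffOn ℝ (⊤ : ℕ∞) (iterDirDeriv L f) Ω := by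
  induction L with
  | nil => exact hf
  | cons v L ih => exact ih.dirDeriv hΩ v

theorem Set.EqOn.dirDeriv (hΩ : IsOpen Ω) (h : Set.EqOn f g Ω) (v : E) :
    Set.EqOn (dirDeriv v f) (dirDeriv v g) Ω := fun y hy => by
  have : f =ᶠ[nhds y] g := h.eventuallyEq_of_mem (hΩ.mem_nhds hy)
  simp only [_root_.dirDeriv, this.fderiv_eq]

theorem Set.EqOn.iterDirDeriv (hΩ : IsOpen Ω) (h : Set.EqOn f g Ω) (L : List E) :
    Set.EqOn (iterDirDeriv L f) (iterDirDeriv L g) Ω := by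
  induction L with
  | nil => exact h
  | cons v L ih => exact ih.dirDeriv hΩ v

theorem dirDeriv_comm (hΩ : IsOpen Ω) (hf : ContDiffOn ℝ (⊤ : ℕ∞) f Ω) (v w : E) :
    Set.EqOn (dirDeriv v (dirDeriv w f)) (dirDeriv w (dirDeriv v f)) Ω := fun y hy => by
  have hat : ContDiffAt ℝ (⊤ : ℕ∞) f y := hf.contDiffAt (hΩ.mem_nhds hy)
  have hd : DifferentiableAt ℝ (fderiv ℝ f) y :=
    (hat.fderiv_right (m := (⊤ : ℕ∞)) (by simp)).differentiableAt (by simp)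
  have key : ∀ u u' : E, dirDeriv u (dirDeriv u' f) y = fderiv ℝ (fderiv ℝ f) y u u' := by
    intro u u'
    change fderiv ℝ (fun x => fderiv ℝ f x u') y u = _
    rw [fderiv_clm_apply hd (differentiableAt_const u')]
    simp
  rw [key, key]
  refine hat.isSymmSndFDerivAt ?_ v w
  rw [minSmoothness_of_isRCLikeNormedField]
  exact WithTop.coe_le_coe.2 (le_top : (2 : ℕ∞) ≤ ⊤)

theorem iterDirDeriv_perm (hΩ : IsOpen Ω) (hf : ContDiffOn ℝ (⊤ : ℕ∞) f Ω) {L L' : List E}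
    (h : L.Perm L') : Set.EqOn (iterDirDeriv L f) (iterDirDeriv L' f) Ω := by
  induction h with
  | nil => exact fun _ _ => rfl
  | cons v _ ih => exact ih.dirDeriv hΩ v
  | swap v w L => exact dirDeriv_comm hΩ (hf.iterDirDeriv hΩ L) w v
  | trans _ _ ih ih' => exact ih.trans ih'

theorem iterDirDeriv_sum (hΩ : IsOpen Ω) {ι : Type*} (s : Finset ι) (c : ι → ℂ) {F : ι → E → ℂ}
    (hF : ∀ i, ContDiffOn ℝ (⊤ : ℕ∞) (F i) Ω) (L : List E) :
    Set.EqOn (iterDirDeriv L fun y => ∑ i ∈ s, c i * F i y)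
      (fun y => ∑ i ∈ s, c i * iterDirDeriv L (F i) y) Ω := by
  induction L with
  | nil => exact fun _ _ => rfl
  | cons v L ih =>
    refine (ih.dirDeriv hΩ v).trans fun y hy => ?_
    have hd : ∀ i, DifferentiableAt ℝ (iterDirDeriv L (F i)) y := fun i =>
      (((hF i).iterDirDeriv hΩ L).contDiffAt (hΩ.mem_nhds hy)).differentiableAt (by simp)
    simp only [dirDeriv]
    rw [fderiv_fun_sum fun i _ => (hd i).const_mul (c i), sum_apply]
    refine Finset.sum_congr rfl fun i _ => ?_
    rw [fderiv_const_mul (hd i)]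
    rfl

end IteratedDirectionalDerivative

section MultiIndexDerivative

variable {d : ℕ}

/-- The list of directions along which `Dm d jx jt` differentiates. -/
def directions (d : ℕ) (jx : Fin d → ℕ) (jt : ℕ) : List ((Fin d → ℝ) × ℝ) :=
  List.replicate jt (0, 1) ++
    (List.finRange d).flatMap fun ℓ => List.replicate (jx ℓ) (Pi.single ℓ 1, 0)

theorem Dm_eq_iterDirDeriv (jx : Fin d → ℕ) (jt : ℕ) (f : (Fin d → ℝ) × ℝ → ℂ) :
    Dm d jx jt f = iterDirDeriv (directions d jx jt) f := by
  rw [directions, iterDirDeriv_append, iterDirDeriv_replicate, Dm]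
  congr 1
  induction List.finRange d with
  | nil => rfl
  | cons ℓ l ih =>
    rw [List.flatMap_cons, iterDirDeriv_append, iterDirDeriv_replicate, ← ih]
    rfl

theorem coe_directions (jx : Fin d → ℕ) (jt : ℕ) :
    (directions d jx jt : Multiset ((Fin d → ℝ) × ℝ)) =
      Multiset.replicate jt (0, 1) + ∑ ℓ, Multiset.replicate (jx ℓ) (Pi.single ℓ 1, 0) := by
  have h : ∀ l : List (Fin d),
      ((l.flatMap fun ℓ => List.replicate (jx ℓ) ((Pi.single ℓ 1, 0) : (Fin d → ℝ) × ℝ) :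
        List _) : Multiset _) =
      (l.map fun ℓ => Multiset.replicate (jx ℓ) ((Pi.single ℓ 1, 0) : (Fin d → ℝ) × ℝ)).sum := by
    intro l
    induction l with
    | nil => rfl
    | cons ℓ l ih =>
      rw [List.flatMap_cons, ← Multiset.coe_add, ih, List.map_cons, List.sum_cons,
        Multiset.coe_replicate]
  rw [directions, ← Multiset.coe_add, h, Fin.sum_univ_def, Multiset.coe_replicate]

theorem directions_succ_perm (jx : Fin d → ℕ) (jt : ℕ) :
    (directions d jx (jt + 1)).Perm (directions d jx jt ++ [(0, 1)]) := by
  rw [← Multiset.coe_eq_coe, ← Multiset.coe_add, coe_directions, coe_directions,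
    Multiset.replicate_add, add_right_comm]
  rfl

theorem directions_add_single_perm (jx : Fin d → ℕ) (jt : ℕ) (ℓ : Fin d) :
    (directions d (jx + Pi.single ℓ 2) jt).Perm
      (directions d jx jt ++ [(Pi.single ℓ 1, 0), (Pi.single ℓ 1, 0)]) := by
  rw [← Multiset.coe_eq_coe, ← Multiset.coe_add, coe_directions, coe_directions, add_assoc]
  simp only [Pi.add_apply, Multiset.replicate_add, Finset.sum_add_distrib]
  rw [Finset.sum_eq_single_of_mem (f := fun m => Multiset.replicate
    ((Pi.single ℓ 2 : Fin d → ℕ) m) ((Pi.single m 1, 0) : (Fin d → ℝ) × ℝ)) ℓ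
    (Finset.mem_univ ℓ) fun m _ hm => by simp [hm]]
  rw [Pi.single_eq_same]
  rfl

theorem Dm_trefftz {Ω : Set ((Fin d → ℝ) × ℝ)} (hΩ : IsOpen Ω) {ψ : (Fin d → ℝ) × ℝ → ℂ}
    (hψ : ContDiffOn ℝ (⊤ : ℕ∞) ψ Ω)
    (htrefftz : ∀ y ∈ Ω, Complex.I * pT d ψ y + (1/2 : ℂ) * ∑ ℓ, pS d ℓ (pS d ℓ ψ) y = 0)
    (jx : Fin d → ℕ) (jt : ℕ) {y : (Fin d → ℝ) × ℝ} (hy : y ∈ Ω) :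
    (-2 : ℂ) * Complex.I * Dm d jx (jt + 1) ψ y = ∑ ℓ, Dm d (jx + Pi.single ℓ 2) jt ψ y := by
  have hT : Set.EqOn (pT d ψ) (fun y => ∑ ℓ, Complex.I / 2 * pS d ℓ (pS d ℓ ψ) y) Ω := by
    intro y hy
    beta_reduce
    rw [← Finset.mul_sum]
    linear_combination (-Complex.I) * htrefftz y hy + pT d ψ y * Complex.I_sq
  have hS : ∀ ℓ, ContDiffOn ℝ (⊤ : ℕ∞) (pS d ℓ (pS d ℓ ψ)) Ω := fun ℓ =>
    (hψ.dirDeriv hΩ (Pi.single ℓ 1, 0)).dirDeriv hΩ (Pi.single ℓ 1, 0)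
  have h₁ : Dm d jx (jt + 1) ψ y =
      ∑ ℓ, Complex.I / 2 * iterDirDeriv (directions d jx jt) (pS d ℓ (pS d ℓ ψ)) y := by
    rw [Dm_eq_iterDirDeriv, iterDirDeriv_perm hΩ hψ (directions_succ_perm jx jt) hy,
      iterDirDeriv_append]
    exact (hT.iterDirDeriv hΩ _ hy).trans (iterDirDeriv_sum hΩ _ _ hS _ hy)
  have h₂ : ∀ ℓ, Dm d (jx + Pi.single ℓ 2) jt ψ y =
      iterDirDeriv (directions d jx jt) (pS d ℓ (pS d ℓ ψ)) y := fun ℓ => by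
    rw [Dm_eq_iterDirDeriv, iterDirDeriv_perm hΩ hψ (directions_add_single_perm jx jt ℓ) hy,
      iterDirDeriv_append]
    rfl
  simp only [h₁, h₂, ← Finset.mul_sum]
  linear_combination (-∑ ℓ, iterDirDeriv (directions d jx jt) (pS d ℓ (pS d ℓ ψ)) y) *
    Complex.I_sq

end MultiIndexDerivative

section TaylorMonomial

variable {d : ℕ}

/-- The normalized power `r ^ n / n!`. -/
def dividedPow (n : ℕ) (r : ℝ) : ℂ := (n.factorial : ℂ)⁻¹ * (r : ℂ) ^ n

theorem hasDerivAt_dividedPow (n : ℕ) (r : ℝ) :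
    HasDerivAt (dividedPow n) (if n = 0 then 0 else dividedPow (n - 1) r) r := by
  have h := ((hasDerivAt_id r).ofReal_comp.pow n).const_mul ((n.factorial : ℂ)⁻¹)
  refine h.congr_deriv ?_
  cases n with
  | zero => simp
  | succ n =>
    have : ((n : ℂ) + 1) ≠ 0 := by exact_mod_cast n.succ_ne_zero
    have : (n.factorial : ℂ) ≠ 0 := by exact_mod_cast n.factorial_ne_zero
    simp only [dividedPow, Nat.factorial_succ, id, Nat.add_sub_cancel, Nat.succ_ne_zero, if_false]
    push_cast
    field_simp

/-- The Taylor monomial `(x - z)^jx (t - s)^jt / (jx! jt!)`. -/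
def taylorMonomial (z : Fin d → ℝ) (s : ℝ) (j : (Fin d → ℕ) × ℕ) (y : (Fin d → ℝ) × ℝ) : ℂ :=
  (∏ ℓ, dividedPow (j.1 ℓ) (y.1 ℓ - z ℓ)) * dividedPow j.2 (y.2 - s)

theorem taylorMonomial_eq (z : Fin d → ℝ) (s : ℝ) (jx : Fin d → ℕ) (jt : ℕ)
    (y : (Fin d → ℝ) × ℝ) :
    taylorMonomial z s (jx, jt) y = (((∏ ℓ, (jx ℓ).factorial) * jt.factorial : ℕ) : ℂ)⁻¹ *
      (∏ ℓ, ((y.1 ℓ - z ℓ : ℝ) : ℂ) ^ jx ℓ) * ((y.2 - s : ℝ) : ℂ) ^ jt := by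
  simp only [taylorMonomial, dividedPow, Finset.prod_mul_distrib, Finset.prod_inv_distrib]
  push_cast
  rw [mul_inv]
  ring

theorem differentiable_taylorMonomial (z : Fin d → ℝ) (s : ℝ) (j : (Fin d → ℕ) × ℕ) :
    Differentiable ℝ (taylorMonomial z s j) := by
  have h : ∀ n, Differentiable ℝ (dividedPow n) := fun n r =>
    (hasDerivAt_dividedPow n r).differentiableAt
  have hx : ∀ ℓ, Differentiable ℝ fun y : (Fin d → ℝ) × ℝ => dividedPow (j.1 ℓ) (y.1 ℓ - z ℓ) :=
    fun ℓ => (h _).comp (by fun_prop)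
  have ht : Differentiable ℝ fun y : (Fin d → ℝ) × ℝ => dividedPow j.2 (y.2 - s) :=
    (h _).comp (by fun_prop)
  unfold taylorMonomial
  fun_prop

theorem pT_taylorMonomial (z : Fin d → ℝ) (s : ℝ) (j : (Fin d → ℕ) × ℕ) (y : (Fin d → ℝ) × ℝ) :
    pT d (taylorMonomial z s j) y =
      if j.2 = 0 then 0 else taylorMonomial z s (j.1, j.2 - 1) y := by
  rw [pT, ← (differentiable_taylorMonomial z s j y).lineDeriv_eq_fderiv]
  refine HasDerivAt.deriv ?_
  have h₀ := hasDerivAt_dividedPow j.2 (y.2 + 0 - s)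
  have h := (((h₀.comp_sub_const (y.2 + 0) s).comp_const_add y.2 0).const_mul
    (∏ ℓ, dividedPow (j.1 ℓ) (y.1 ℓ - z ℓ)))
  refine (h.congr_of_eventuallyEq (.of_forall fun r => ?_)).congr_deriv ?_
  · simp [taylorMonomial]
  · split_ifs <;> simp [taylorMonomial]

theorem pS_taylorMonomial (z : Fin d → ℝ) (s : ℝ) (ℓ : Fin d) (j : (Fin d → ℕ) × ℕ)
    (y : (Fin d → ℝ) × ℝ) :
    pS d ℓ (taylorMonomial z s j) y =
      if j.1 ℓ = 0 then 0 else taylorMonomial z s (j.1 - Pi.single ℓ 1, j.2) y := by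
  have hsplit : ∀ (j : (Fin d → ℕ) × ℕ) (y : (Fin d → ℝ) × ℝ), taylorMonomial z s j y =
      dividedPow (j.1 ℓ) (y.1 ℓ - z ℓ) * ((∏ m ∈ Finset.univ.erase ℓ,
        dividedPow (j.1 m) (y.1 m - z m)) * dividedPow j.2 (y.2 - s)) := fun j y => by
    rw [taylorMonomial, ← Finset.mul_prod_erase _ _ (Finset.mem_univ ℓ), mul_assoc]
  rw [pS, ← (differentiable_taylorMonomial z s j y).lineDeriv_eq_fderiv]
  refine HasDerivAt.deriv ?_
  have h₀ := hasDerivAt_dividedPow (j.1 ℓ) (y.1 ℓ + 0 - z ℓ)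
  have h := (((h₀.comp_sub_const (y.1 ℓ + 0) (z ℓ)).comp_const_add (y.1 ℓ) 0).mul_const
    ((∏ m ∈ Finset.univ.erase ℓ, dividedPow (j.1 m) (y.1 m - z m)) * dividedPow j.2 (y.2 - s)))
  refine (h.congr_of_eventuallyEq (.of_forall fun r => ?_)).congr_deriv ?_
  · rw [hsplit]
    congr 2
    · simp
    · refine Finset.prod_congr rfl fun m hm => ?_
      simp [Finset.ne_of_mem_erase hm]
    · simp
  · rw [ite_mul, zero_mul, hsplit]
    congr 2
    · simp
    · congr 1
      refine Finset.prod_congr rfl fun m hm => ?_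
      simp [Finset.ne_of_mem_erase hm]

end TaylorMonomial

section TaylorSum

variable {d : ℕ}

/-- Multi-indices `(jx, jt)` of total order less than `N`. -/
def indexSet (d N : ℕ) : Finset ((Fin d → ℕ) × ℕ) :=
  {j ∈ Fintype.piFinset (fun _ : Fin d => Finset.range N) ×ˢ Finset.range N |
    (∑ ℓ, j.1 ℓ) + j.2 < N}

theorem mem_indexSet {N : ℕ} {j : (Fin d → ℕ) × ℕ} :
    j ∈ indexSet d N ↔ (∑ ℓ, j.1 ℓ) + j.2 < N := by
  simp only [indexSet, Finset.mem_filter, Finset.mem_product, Fintype.mem_piFinset,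
    Finset.mem_range, and_iff_right_iff_imp]
  intro h
  refine ⟨fun ℓ => ?_, by omega⟩
  have := Finset.single_le_sum (f := j.1) (fun _ _ => Nat.zero_le _) (Finset.mem_univ ℓ)
  omega

theorem sum_range_piFinset_ite_eq {N : ℕ} {P : (Fin d → ℕ) × ℕ → Prop} [DecidablePred P]
    (hP : ∀ j, P j → (∑ ℓ, j.1 ℓ) + j.2 < N) (F : (Fin d → ℕ) × ℕ → ℂ) :
    (∑ jt ∈ Finset.range N, ∑ jx ∈ Fintype.piFinset (fun _ : Fin d => Finset.range N),
      if P (jx, jt) then F (jx, jt) else 0) = ∑ j ∈ indexSet d N with P j, F j := by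
  rw [Finset.sum_comm, ← Finset.sum_product', ← Finset.sum_filter, indexSet, Finset.filter_filter]
  refine Finset.sum_congr (Finset.filter_congr fun j _ => ?_) fun _ _ => rfl
  exact ⟨fun h => ⟨hP j h, h⟩, And.right⟩

/-- The polynomial of degree less than `N` with Taylor coefficients `a` centered at `(z, s)`. -/
def taylorSum (z : Fin d → ℝ) (s : ℝ) (N : ℕ) (a : (Fin d → ℕ) × ℕ → ℂ)
    (y : (Fin d → ℝ) × ℝ) : ℂ :=
  ∑ j ∈ indexSet d N, a j * taylorMonomial z s j y

theorem taylorPoly_eq_taylorSum (p : ℕ) (ψ : (Fin d → ℝ) × ℝ → ℂ) (z : Fin d → ℝ) (s : ℝ) :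
    taylorPoly d p ψ z s = taylorSum z s (p + 1) fun j => Dm d j.1 j.2 ψ (z, s) := by
  funext y
  have h := sum_range_piFinset_ite_eq (d := d) (N := p + 1)
    (P := fun j => (∑ ℓ, j.1 ℓ) + j.2 ≤ p) (fun j hj => Nat.lt_succ_of_le hj)
    fun j => Dm d j.1 j.2 ψ (z, s) * taylorMonomial z s j y
  rw [Finset.filter_true_of_mem fun j hj => Nat.le_of_lt_succ (mem_indexSet.1 hj)] at h
  rw [taylorSum, ← h, taylorPoly]
  refine Finset.sum_congr rfl fun jt _ => Finset.sum_congr rfl fun jx _ => ?_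
  rw [taylorMonomial_eq]
  split_ifs <;> ring

theorem fderiv_taylorSum_apply (z : Fin d → ℝ) (s : ℝ) (N : ℕ) (a : (Fin d → ℕ) × ℕ → ℂ)
    (y v : (Fin d → ℝ) × ℝ) :
    fderiv ℝ (taylorSum z s N a) y v =
      ∑ j ∈ indexSet d N, a j * fderiv ℝ (taylorMonomial z s j) y v := by
  have hd := fun j => differentiable_taylorMonomial z s j y
  unfold taylorSum
  rw [fderiv_fun_sum fun j _ => (hd j).const_mul (a j), sum_apply]
  refine Finset.sum_congr rfl fun j _ => ?_
  rw [fderiv_const_mul (hd j)]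
  rfl

theorem pT_taylorSum (z : Fin d → ℝ) (s : ℝ) (N : ℕ) (a : (Fin d → ℕ) × ℕ → ℂ) :
    pT d (taylorSum z s N a) = taylorSum z s (N - 1) fun j => a (j.1, j.2 + 1) := by
  funext y
  rw [pT, fderiv_taylorSum_apply]
  symm
  refine Finset.sum_of_injOn (fun j => (j.1, j.2 + 1)) ?_ ?_ ?_ ?_
  · rintro ⟨a, b⟩ _ ⟨a', b'⟩ _ h
    simpa using h
  · intro j hj
    have := mem_indexSet.1 (Finset.mem_coe.1 hj)
    refine Finset.mem_coe.2 (mem_indexSet.2 ?_)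
    dsimp only
    omega
  · intro j hj hj'
    suffices h : j.2 = 0 by
      have := pT_taylorMonomial z s j y
      rw [if_pos h, pT] at this
      rw [this, mul_zero]
    by_contra h
    refine hj' ⟨(j.1, j.2 - 1), ?_, ?_⟩
    · have := mem_indexSet.1 hj
      refine Finset.mem_coe.2 (mem_indexSet.2 ?_)
      dsimp only
      omega
    · exact Prod.ext rfl (Nat.succ_pred h)
  · intro j _
    have := pT_taylorMonomial z s (j.1, j.2 + 1) y
    rw [pT] at this
    rw [this]
    simp

theorem pS_taylorSum (z : Fin d → ℝ) (s : ℝ) (ℓ : Fin d) (N : ℕ) (a : (Fin d → ℕ) × ℕ → ℂ) :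
    pS d ℓ (taylorSum z s N a) =
      taylorSum z s (N - 1) fun j => a (j.1 + Pi.single ℓ 1, j.2) := by
  funext y
  have hsum : ∀ i : Fin d → ℕ, ∑ m, (i + Pi.single ℓ 1 : Fin d → ℕ) m = (∑ m, i m) + 1 := fun i => by
    simp [Finset.sum_add_distrib]
  rw [pS, fderiv_taylorSum_apply]
  symm
  refine Finset.sum_of_injOn (fun j => (j.1 + Pi.single ℓ 1, j.2)) ?_ ?_ ?_ ?_
  · rintro ⟨a, b⟩ _ ⟨a', b'⟩ _ h
    simpa using h
  · intro j hj
    have := mem_indexSet.1 (Finset.mem_coe.1 hj)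
    refine Finset.mem_coe.2 (mem_indexSet.2 ?_)
    rw [hsum]
    dsimp only
    omega
  · intro j hj hj'
    suffices h : j.1 ℓ = 0 by
      have := pS_taylorMonomial z s ℓ j y
      rw [if_pos h, pS] at this
      rw [this, mul_zero]
    by_contra h
    have hcancel : j.1 - Pi.single ℓ 1 + Pi.single ℓ 1 = j.1 := by
      funext m
      rcases eq_or_ne m ℓ with rfl | hm
      · simpa using Nat.succ_pred h
      · simp [hm]
    refine hj' ⟨(j.1 - Pi.single ℓ 1, j.2), ?_, Prod.ext hcancel rfl⟩
    have := mem_indexSet.1 hj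
    have hs := hsum (j.1 - Pi.single ℓ 1)
    rw [hcancel] at hs
    refine Finset.mem_coe.2 (mem_indexSet.2 ?_)
    dsimp only
    omega
  · intro j _
    have := pS_taylorMonomial z s ℓ (j.1 + Pi.single ℓ 1, j.2) y
    rw [pS] at this
    rw [this]
    simp

end TaylorSum

/-- For a smooth Trefftz function `ψ` on an open `Ω ∋ (z,s)`, the Taylor polynomial
`T^{p+1}` of order `p+1` centered at `(z,s)` satisfies, on all of `ℝ^d × ℝ`,
`−2i ∂_t T^{p+1} = Δ_x T^{p+1}
  + Σ_{|j_x|+j_t = p−1} Σ_{ℓ=1}^d (1/(j_x! j_t!)) D^{(j_x+2e_ℓ, j_t)} ψ(z,s) (x−z)^{j_x} (t−s)^{j_t}`. -/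
theorem taylor_schrodinger_identity (d p : ℕ) (hd : 1 ≤ d) (hp : 1 ≤ p)
    (Ω : Set ((Fin d → ℝ) × ℝ)) (hΩ : IsOpen Ω) (z : Fin d → ℝ) (s : ℝ) (hzs : (z, s) ∈ Ω)
    (ψ : (Fin d → ℝ) × ℝ → ℂ) (hsmooth : ContDiffOn ℝ (⊤ : ℕ∞) ψ Ω)
    (htrefftz : ∀ y ∈ Ω, Complex.I * pT d ψ y + (1/2 : ℂ) * ∑ ℓ, pS d ℓ (pS d ℓ ψ) y = 0) :
    ∀ y : (Fin d → ℝ) × ℝ,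
      (-2 : ℂ) * Complex.I * pT d (taylorPoly d p ψ z s) y
        = (∑ ℓ, pS d ℓ (pS d ℓ (taylorPoly d p ψ z s)) y)
          + ∑ jt ∈ Finset.range p, ∑ jx ∈ Fintype.piFinset (fun _ : Fin d => Finset.range p),
              if (∑ ℓ, jx ℓ) + jt = p - 1 then
                ∑ ℓ, (((∏ m, (jx m).factorial) * jt.factorial : ℕ) : ℂ)⁻¹ *
                  Dm d (jx + Pi.single ℓ 2) jt ψ (z, s) *
                  (∏ m, ((y.1 m - z m : ℝ) : ℂ) ^ jx m) * ((y.2 - s : ℝ) : ℂ) ^ jt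
              else 0 := by
  intro y
  set b : Fin d → (Fin d → ℕ) × ℕ → ℂ := fun ℓ j => Dm d (j.1 + Pi.single ℓ 2) j.2 ψ (z, s) with hb
  have htop : (∑ jt ∈ Finset.range p, ∑ jx ∈ Fintype.piFinset (fun _ : Fin d => Finset.range p),
      if (∑ ℓ, jx ℓ) + jt = p - 1 then
        ∑ ℓ, (((∏ m, (jx m).factorial) * jt.factorial : ℕ) : ℂ)⁻¹ *
          Dm d (jx + Pi.single ℓ 2) jt ψ (z, s) *
          (∏ m, ((y.1 m - z m : ℝ) : ℂ) ^ jx m) * ((y.2 - s : ℝ) : ℂ) ^ jt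
      else 0) = ∑ j ∈ indexSet d p with (∑ ℓ, j.1 ℓ) + j.2 = p - 1,
        ∑ ℓ, b ℓ j * taylorMonomial z s j y := by
    rw [← sum_range_piFinset_ite_eq fun j hj => by omega]
    refine Finset.sum_congr rfl fun jt _ => Finset.sum_congr rfl fun jx _ => ?_
    refine if_congr Iff.rfl (Finset.sum_congr rfl fun ℓ _ => ?_) rfl
    rw [taylorMonomial_eq]
    ring
  have hlow : ∑ ℓ, pS d ℓ (pS d ℓ (taylorPoly d p ψ z s)) y =
      ∑ j ∈ indexSet d p with ¬ (∑ ℓ, j.1 ℓ) + j.2 = p - 1,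
        ∑ ℓ, b ℓ j * taylorMonomial z s j y := by
    rw [Finset.sum_comm]
    refine Finset.sum_congr rfl fun ℓ _ => ?_
    rw [taylorPoly_eq_taylorSum, pS_taylorSum, pS_taylorSum, taylorSum]
    refine Finset.sum_congr ?_ fun j _ => ?_
    · ext j
      simp only [Finset.mem_filter, mem_indexSet]
      omega
    · rw [hb]
      simp only [add_assoc, ← Pi.single_add, Nat.reduceAdd]
  rw [htop, hlow, add_comm, Finset.sum_filter_add_sum_filter_not, taylorPoly_eq_taylorSum,
    pT_taylorSum, Nat.add_sub_cancel, taylorSum, Finset.mul_sum]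
  refine Finset.sum_congr rfl fun j _ => ?_
  rw [← Finset.sum_mul, ← mul_assoc, Dm_trefftz hΩ hsmooth htrefftz j.1 j.2 hzs]
end
end

section
/- Let d ≥ 1, p ∈ ℕ, and t_0 ∈ ℝ. Let P^{2p}_T := { q ∈ ℂ[x_1, …, x_d, t] : total degree of q ≤ 2p and i ∂_t q + (1/2) Δ_x q = 0 } and P^{2p}(ℝ^d) := { m ∈ ℂ[x_1, …, x_d] : total degree of m ≤ 2p }. Then the restriction map q ↦ q(·, t_0) is a ℂ-linear bijection from P^{2p}_T onto P^{2p}(ℝ^d). -/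
noncomputable section

open MvPolynomial

/-- Restriction to the time slice `t = t_0`: substitute `t ↦ t_0` in a polynomial in
`ℂ[x_1, …, x_d, t]` (variable `some ℓ` is `x_ℓ`, variable `none` is `t`). -/
def restrictTime (d : ℕ) (t₀ : ℝ) (q : MvPolynomial (Option (Fin d)) ℂ) :
    MvPolynomial (Fin d) ℂ :=
  aeval (fun v : Option (Fin d) => v.elim (C ((t₀ : ℝ) : ℂ)) X) q

theorem totalDegree_pderiv_le {σ R : Type*} [CommSemiring R] (i : σ) (f : MvPolynomial σ R) :
    (pderiv i f).totalDegree ≤ f.totalDegree - 1 := by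
  classical
  refine Finset.sup_le fun m hm => ?_
  have hc : coeff (m + Finsupp.single i 1) f ≠ 0 := by
    intro h
    rw [mem_support_iff, coeff_pderiv, h, zero_mul] at hm
    exact hm rfl
  have h := le_totalDegree (mem_support_iff.mpr hc)
  rw [Finsupp.sum_add_index' (by simp) (by simp), Finsupp.sum_single_index rfl] at h
  omega

theorem totalDegree_aeval_le_of_forall_le_one {σ τ R : Type*} [CommSemiring R]
    {f : σ → MvPolynomial τ R} (hf : ∀ v, (f v).totalDegree ≤ 1) (q : MvPolynomial σ R) :
    (aeval f q).totalDegree ≤ q.totalDegree := by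
  rw [aeval_def, eval₂_eq]
  refine totalDegree_finsetSum_le fun m hm => ?_
  refine (totalDegree_mul _ _).trans ?_
  rw [algebraMap_eq, totalDegree_C, zero_add]
  refine ((totalDegree_finsetProd _ _).trans (Finset.sum_le_sum fun v _ => ?_)).trans
    (le_totalDegree hm)
  exact (totalDegree_pow _ _).trans (mul_le_of_le_one_right (Nat.zero_le _) (hf v))

/-- The Laplacian `∑ ∂²/∂x_{v ℓ}²` in the variables selected by `v`. -/
def laplacian {ι σ : Type*} [Fintype ι] (v : ι → σ) :
    MvPolynomial σ ℂ →ₗ[ℂ] MvPolynomial σ ℂ :=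
  ∑ ℓ, (pderiv (v ℓ)).toLinearMap ∘ₗ (pderiv (v ℓ)).toLinearMap

theorem laplacian_apply {ι σ : Type*} [Fintype ι] (v : ι → σ) (f : MvPolynomial σ ℂ) :
    laplacian v f = ∑ ℓ, pderiv (v ℓ) (pderiv (v ℓ) f) := by
  simp [laplacian]

theorem laplacian_rename {ι σ : Type*} [Fintype ι] {v : ι → σ} (hv : Function.Injective v)
    (f : MvPolynomial ι ℂ) :
    laplacian v (rename v f) = rename v (laplacian id f) := by
  simp only [laplacian_apply, map_sum, id, pderiv_rename hv]

theorem laplacian_mul_of_pderiv_eq_zero {ι σ : Type*} [Fintype ι] {v : ι → σ}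
    {g : MvPolynomial σ ℂ} (hg : ∀ ℓ, pderiv (v ℓ) g = 0) (f : MvPolynomial σ ℂ) :
    laplacian v (g * f) = g * laplacian v f := by
  simp only [laplacian_apply, pderiv_mul, hg, zero_mul, zero_add, Finset.mul_sum]

theorem totalDegree_laplacian_le {ι σ : Type*} [Fintype ι] (v : ι → σ) (f : MvPolynomial σ ℂ) :
    (laplacian v f).totalDegree ≤ f.totalDegree - 2 := by
  rw [laplacian_apply]
  refine totalDegree_finsetSum_le fun ℓ _ => ?_
  have h₁ := totalDegree_pderiv_le (v ℓ) (pderiv (v ℓ) f)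
  have h₂ := totalDegree_pderiv_le (v ℓ) f
  omega

theorem laplacian_eq_zero_of_totalDegree_eq_zero {ι σ : Type*} [Fintype ι] (v : ι → σ)
    {f : MvPolynomial σ ℂ} (hf : f.totalDegree = 0) : laplacian v f = 0 := by
  rw [laplacian_apply, totalDegree_eq_zero_iff_eq_C.mp hf]
  simp

theorem totalDegree_laplacian_pow_le {ι σ : Type*} [Fintype ι] (v : ι → σ)
    (f : MvPolynomial σ ℂ) (k : ℕ) :
    ((laplacian v ^ k) f).totalDegree ≤ f.totalDegree - 2 * k := by
  induction k with
  | zero => simp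
  | succ k ih =>
    rw [pow_succ', Module.End.mul_apply]
    have := totalDegree_laplacian_le v ((laplacian v ^ k) f)
    omega

/-- The polynomial `t - a`, where `t` is the variable `none`. -/
def timeShift (ι : Type*) (a : ℂ) : MvPolynomial (Option ι) ℂ := X none - C a

theorem pderiv_none_timeShift {ι : Type*} (a : ℂ) : pderiv none (timeShift ι a) = 1 := by
  simp [timeShift]

theorem pderiv_some_timeShift_pow {ι : Type*} (a : ℂ) (k : ℕ) (ℓ : ι) :
    pderiv (some ℓ) (timeShift ι a ^ k) = 0 := by
  have h : pderiv (some ℓ) (timeShift ι a) = 0 := by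
    simp [timeShift, pderiv_X_of_ne (show (none : Option ι) ≠ some ℓ by simp)]
  rw [pderiv_pow, h, mul_zero]

theorem totalDegree_timeShift {ι : Type*} (a : ℂ) : (timeShift ι a).totalDegree = 1 := by
  rw [timeShift, sub_eq_add_neg, ← C_neg,
    totalDegree_add_eq_left_of_totalDegree_lt (by simp), totalDegree_X]

theorem timeShift_ne_zero {ι : Type*} (a : ℂ) : timeShift ι a ≠ 0 := by
  intro h
  simpa [h] using totalDegree_timeShift (ι := ι) a

theorem totalDegree_timeShift_pow {ι : Type*} (a : ℂ) (k : ℕ) :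
    (timeShift ι a ^ k).totalDegree = k := by
  induction k with
  | zero => simp
  | succ k ih =>
    rw [pow_succ, totalDegree_mul_of_isDomain (pow_ne_zero _ (timeShift_ne_zero a))
      (timeShift_ne_zero a), ih, totalDegree_timeShift]

/-- The Schrödinger operator `i ∂_t + (1/2) Δ_x`. -/
def schrodinger (ι : Type*) [Fintype ι] :
    MvPolynomial (Option ι) ℂ →ₗ[ℂ] MvPolynomial (Option ι) ℂ :=
  Complex.I • (pderiv none).toLinearMap + (1/2 : ℂ) • laplacian some

theorem schrodinger_apply {ι : Type*} [Fintype ι] (q : MvPolynomial (Option ι) ℂ) :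
    schrodinger ι q = Complex.I • pderiv none q + (1/2 : ℂ) • laplacian some q :=
  rfl

theorem restrictTime_rename_some (d : ℕ) (t₀ : ℝ) (m : MvPolynomial (Fin d) ℂ) :
    restrictTime d t₀ (rename some m) = m := by
  rw [restrictTime, aeval_rename]
  exact aeval_X_left_apply m

theorem restrictTime_timeShift (d : ℕ) (t₀ : ℝ) :
    restrictTime d t₀ (timeShift (Fin d) t₀) = 0 := by
  simp [restrictTime, timeShift, algebraMap_eq]

theorem timeShift_dvd_sub_rename_restrictTime (d : ℕ) (t₀ : ℝ)
    (q : MvPolynomial (Option (Fin d)) ℂ) :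
    timeShift (Fin d) t₀ ∣ q - rename some (restrictTime d t₀ q) := by
  induction q using MvPolynomial.induction_on with
  | C a => simp [restrictTime, algebraMap_eq]
  | add q₁ q₂ h₁ h₂ =>
    convert dvd_add h₁ h₂ using 1
    simp only [restrictTime, map_add]
    ring
  | mul_X q v h =>
    have hv : timeShift (Fin d) t₀ ∣ X v - rename some (restrictTime d t₀ (X v)) := by
      cases v <;> simp [restrictTime, timeShift]
    convert dvd_add (h.mul_right (X v)) (hv.mul_left (rename some (restrictTime d t₀ q))) using 1
    simp only [restrictTime, map_mul]
    ring

theorem timeShift_dvd_of_restrictTime_eq_zero {d : ℕ} {t₀ : ℝ}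
    {q : MvPolynomial (Option (Fin d)) ℂ} (hq : restrictTime d t₀ q = 0) :
    timeShift (Fin d) t₀ ∣ q := by
  simpa [hq] using timeShift_dvd_sub_rename_restrictTime d t₀ q

theorem timeShift_pow_dvd_of_schrodinger_eq_zero {ι : Type*} [Fintype ι] {a : ℂ}
    {q : MvPolynomial (Option ι) ℂ} (hS : schrodinger ι q = 0) (h : timeShift ι a ∣ q) (k : ℕ) :
    timeShift ι a ^ (k + 1) ∣ q := by
  induction k with
  | zero => simpa using h
  | succ k ih =>
    obtain ⟨r, rfl⟩ := ih
    rw [schrodinger_apply, laplacian_mul_of_pderiv_eq_zero (pderiv_some_timeShift_pow a _),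
      pderiv_mul, pderiv_pow, pderiv_none_timeShift] at hS
    set τ := timeShift ι a
    have hk : τ ^ k * (C (Complex.I * (k + 1)) * r +
        τ * (C Complex.I * pderiv none r + C (1 / 2) * laplacian some r)) = 0 := by
      rw [← hS]
      simp only [smul_eq_C_mul, C_mul, map_add, map_natCast, map_one, Nat.cast_add, Nat.cast_one,
        Nat.add_sub_cancel]
      ring
    have hr := (mul_eq_zero.mp hk).resolve_left (pow_ne_zero _ (timeShift_ne_zero a))
    have hc : Complex.I * (k + 1) ≠ 0 :=
      mul_ne_zero Complex.I_ne_zero (by exact_mod_cast k.succ_ne_zero)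
    have hdvd : τ ∣ C (Complex.I * (k + 1)) * r := by
      rw [eq_neg_of_add_eq_zero_left hr]
      exact (dvd_mul_right _ _).neg_right
    have hu : IsUnit (C (Complex.I * (k + 1)) : MvPolynomial (Option ι) ℂ) :=
      (isUnit_iff_ne_zero.mpr hc).map C
    rw [pow_succ]
    exact mul_dvd_mul_left _ (hu.dvd_mul_left.mp hdvd)

theorem eq_zero_of_schrodinger_eq_zero_of_timeShift_dvd {ι : Type*} [Fintype ι] {a : ℂ}
    {q : MvPolynomial (Option ι) ℂ} (hS : schrodinger ι q = 0) (h : timeShift ι a ∣ q) :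
    q = 0 := by
  by_contra hq
  obtain ⟨r, hr⟩ := timeShift_pow_dvd_of_schrodinger_eq_zero hS h q.totalDegree
  have hr0 : r ≠ 0 := by
    rintro rfl
    exact hq (by simpa using hr)
  have hdeg := congrArg totalDegree hr
  rw [totalDegree_mul_of_isDomain (pow_ne_zero _ (timeShift_ne_zero a)) hr0,
    totalDegree_timeShift_pow] at hdeg
  omega

/-- The truncated evolution `∑_{k ≤ n} (t - a)^k / k! · ((i/2) Δ)^k m` of the initial datum `m`. -/
def taylorEvolution {ι : Type*} [Fintype ι] (a : ℂ) (n : ℕ) (m : MvPolynomial ι ℂ) :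
    MvPolynomial (Option ι) ℂ :=
  ∑ k ∈ Finset.range (n + 1),
    ((Complex.I / 2) ^ k / k.factorial) • (timeShift ι a ^ k * rename some ((laplacian id ^ k) m))

theorem schrodinger_taylorEvolution {ι : Type*} [Fintype ι] (a : ℂ) (n : ℕ)
    (m : MvPolynomial ι ℂ) :
    schrodinger ι (taylorEvolution a n m) =
      ((1 / 2) * (Complex.I / 2) ^ n / n.factorial) •
        (timeShift ι a ^ n * rename some ((laplacian id ^ (n + 1)) m)) := by
  have hx (k : ℕ) : laplacian some (timeShift ι a ^ k * rename some ((laplacian id ^ k) m)) =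
      timeShift ι a ^ k * rename some ((laplacian id ^ (k + 1)) m) := by
    rw [laplacian_mul_of_pderiv_eq_zero (pderiv_some_timeShift_pow a k),
      laplacian_rename (Option.some_injective ι), pow_succ' (laplacian id), Module.End.mul_apply]
  have ht (f : MvPolynomial ι ℂ) : pderiv none (rename some f) = 0 := by
    refine pderiv_eq_zero_of_notMem_vars fun h => ?_
    classical
    simpa using vars_rename some f h
  induction n with
  | zero =>
    simp [taylorEvolution, schrodinger_apply, ht, laplacian_rename (Option.some_injective ι)]
  | succ n ih =>
    rw [taylorEvolution, Finset.sum_range_succ, map_add, ← taylorEvolution, ih, map_smul,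
      schrodinger_apply, hx, pderiv_mul, ht, pderiv_pow, pderiv_none_timeShift]
    have hn : (n.factorial : ℂ) ≠ 0 := by exact_mod_cast n.factorial_ne_zero
    have hn' : (n : ℂ) + 1 ≠ 0 := by exact_mod_cast n.succ_ne_zero
    have hc : (1 / 2) * (Complex.I / 2) ^ n / (n.factorial : ℂ) +
        (Complex.I / 2) ^ (n + 1) / ((n + 1).factorial : ℂ) * (Complex.I * (n + 1)) = 0 := by
      rw [Nat.factorial_succ]
      push_cast
      field_simp
      linear_combination (Complex.I ^ n * (1 / 2) ^ n) * Complex.I_sq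
    rw [show (1 / 2) * (Complex.I / 2) ^ (n + 1) / ((n + 1).factorial : ℂ) =
      (Complex.I / 2) ^ (n + 1) / ((n + 1).factorial : ℂ) * (1 / 2) by ring]
    have hC := congrArg (C : ℂ → MvPolynomial (Option ι) ℂ) hc
    simp only [C_mul, map_add, map_natCast, map_one, map_zero] at hC
    simp only [smul_eq_C_mul, C_mul, Nat.cast_add, Nat.cast_one, Nat.add_sub_cancel]
    linear_combination (timeShift ι a ^ n * rename some ((laplacian id ^ (n + 1)) m)) * hC

theorem totalDegree_taylorEvolution_le {ι : Type*} [Fintype ι] (a : ℂ) {p : ℕ}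
    {m : MvPolynomial ι ℂ} (hm : m.totalDegree ≤ 2 * p) :
    (taylorEvolution a p m).totalDegree ≤ 2 * p := by
  refine totalDegree_finsetSum_le fun k hk => (totalDegree_smul_le _ _).trans ?_
  have h₁ := totalDegree_mul (timeShift ι a ^ k) (rename some ((laplacian id ^ k) m))
  rw [totalDegree_timeShift_pow] at h₁
  have h₃ := totalDegree_rename_le some ((laplacian id ^ k) m)
  have h₄ := totalDegree_laplacian_pow_le id m k
  have h₅ := Finset.mem_range.mp hk
  omega

theorem restrictTime_taylorEvolution (d n : ℕ) (t₀ : ℝ) (m : MvPolynomial (Fin d) ℂ) :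
    restrictTime d t₀ (taylorEvolution (t₀ : ℂ) n m) = m := by
  have h := restrictTime_timeShift d t₀
  have hr := restrictTime_rename_some d t₀
  unfold restrictTime at h hr ⊢
  simp only [taylorEvolution, Finset.sum_range_succ', map_add, map_sum, map_smul, map_mul,
    map_pow, h, hr]
  simp

/-- The restriction map `q ↦ q(·, t_0)` is a `ℂ`-linear bijection from the space of Trefftz
polynomials (`i ∂_t q + (1/2) Δ_x q = 0`) of total degree at most `2p` in `(x, t)` onto the
space of polynomials of total degree at most `2p` in `x`. -/
theorem restrictTime_bijOn_trefftz (d p : ℕ) (hd : 1 ≤ d) (t₀ : ℝ) :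
    (∀ q₁ q₂ : MvPolynomial (Option (Fin d)) ℂ,
        restrictTime d t₀ (q₁ + q₂) = restrictTime d t₀ q₁ + restrictTime d t₀ q₂) ∧
    (∀ (c : ℂ) (q : MvPolynomial (Option (Fin d)) ℂ),
        restrictTime d t₀ (c • q) = c • restrictTime d t₀ q) ∧
    Set.BijOn (restrictTime d t₀)
      {q : MvPolynomial (Option (Fin d)) ℂ | q.totalDegree ≤ 2 * p ∧
        Complex.I • pderiv (none : Option (Fin d)) q
          + (1/2 : ℂ) • ∑ ℓ : Fin d, pderiv (some ℓ) (pderiv (some ℓ) q) = 0}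
      {m : MvPolynomial (Fin d) ℂ | m.totalDegree ≤ 2 * p} := by
  have hadd (q₁ q₂ : MvPolynomial (Option (Fin d)) ℂ) :
      restrictTime d t₀ (q₁ + q₂) = restrictTime d t₀ q₁ + restrictTime d t₀ q₂ := map_add _ _ _
  have hS (q : MvPolynomial (Option (Fin d)) ℂ) :
      Complex.I • pderiv none q + (1/2 : ℂ) • ∑ ℓ : Fin d, pderiv (some ℓ) (pderiv (some ℓ) q) =
        schrodinger (Fin d) q := by
    rw [schrodinger_apply, laplacian_apply]
  refine ⟨hadd, fun c q => map_smul _ c q, fun q hq => ?_, ?_, ?_⟩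
  · refine (totalDegree_aeval_le_of_forall_le_one (fun v => ?_) q).trans hq.1
    cases v <;> simp
  · rintro q₁ ⟨-, h₁⟩ q₂ ⟨-, h₂⟩ h
    rw [hS] at h₁ h₂
    refine sub_eq_zero.mp (eq_zero_of_schrodinger_eq_zero_of_timeShift_dvd (a := t₀) ?_
      (timeShift_dvd_of_restrictTime_eq_zero ?_))
    · rw [map_sub, h₁, h₂, sub_zero]
    · exact (map_sub _ _ _).trans (sub_eq_zero.mpr h)
  · intro m hm
    refine ⟨taylorEvolution (t₀ : ℂ) p m, ⟨totalDegree_taylorEvolution_le _ hm, ?_⟩,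
      restrictTime_taylorEvolution d p t₀ m⟩
    have hdeg : ((laplacian id ^ p) m).totalDegree = 0 := by
      have := totalDegree_laplacian_pow_le id m p
      have hm' : m.totalDegree ≤ 2 * p := hm
      omega
    rw [hS, schrodinger_taylorEvolution, pow_succ' (laplacian id), Module.End.mul_apply,
      laplacian_eq_zero_of_totalDegree_eq_zero id hdeg]
    simp
end
end
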